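/- arXiv:2211.01725 — 5 statements merged into one kernel-verified Lean document; each statement's English description precedes it below -/
import Mathlib

section
/- Let F be a forest on a finite vertex set of size n ≥ 1. Then the number of vertices of F having degree at most 2 is at least n/3. (Equivalently, at most a 2/3 fraction of the vertices have degree at least 3.) -/
/-- In a forest `F` on a finite vertex set of size `n ≥ 1`,
the number of vertices of degree at most `2` is at least `n / 3`. -/
theorem forest_third_low_degree {V : Type*} [Fintype V] [DecidableEq V]
    (F : SimpleGraph V) [DecidableRel F.Adj]
    (hF : F.IsAcyclic) (hn : 1 ≤ Fintype.card V) :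
    (Fintype.card V : ℚ) / 3 ≤
      ((Finset.univ.filter fun v => F.degree v ≤ 2).card : ℚ) := by
  classical
  have hne : Nonempty V := Fintype.card_pos_iff.mp hn
  obtain ⟨T, hFT, -, hT⟩ :=
    (SimpleGraph.connected_top (V := V)).exists_isTree_le_of_le_of_isAcyclic le_top hF
  have h1 := hT.card_edgeFinset
  have h2 : F.edgeFinset.card ≤ T.edgeFinset.card :=
    Finset.card_le_card (SimpleGraph.edgeFinset_mono hFT)
  have h3 := F.sum_degrees_eq_twice_card_edges
  have h4 : ∑ v : V, 3 ≤ ∑ v : V, (F.degree v + 3 * (if F.degree v ≤ 2 then 1 else 0)) := by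
    apply Finset.sum_le_sum
    intro v _
    split_ifs <;> omega
  rw [Finset.sum_add_distrib, ← Finset.mul_sum, ← Finset.card_filter, h3] at h4
  simp only [Finset.sum_const, Finset.card_univ, smul_eq_mul] at h4
  have h5 : Fintype.card V ≤ 3 * (Finset.univ.filter fun v => F.degree v ≤ 2).card := by omega
  have h6 : (Fintype.card V : ℚ) ≤ 3 * ((Finset.univ.filter fun v => F.degree v ≤ 2).card : ℚ) := by
    exact_mod_cast h5
  linarith
end

section
/- Let F be a forest on a finite vertex set V with |V| = n. Define a decreasing sequence of vertex sets by S_0 = V and S_{k+1} = { v ∈ S_k : the degree of v in the subgraph of F induced on S_k is at least 3 }. Then for every natural number k, |S_k| ≤ (2/3)^k · n. -/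
theorem sum_deg_le_aux {W : Type*} [Fintype W] [DecidableEq W]
    (G : SimpleGraph W) [DecidableRel G.Adj] (hG : G.IsAcyclic) :
    ∑ v, G.degree v ≤ 2 * Fintype.card W := by
  classical
  rw [G.sum_degrees_eq_twice_card_edges]
  rcases isEmpty_or_nonempty W with h | h
  · have h2 := G.sum_degrees_eq_twice_card_edges
    rw [← h2]
    simp
  · obtain ⟨T, hGT, -, hT⟩ :=
      (SimpleGraph.connected_top (V := W)).exists_isTree_le_of_le_of_isAcyclic le_top hG
    have h1 := hT.card_edgeFinset
    have h2 : G.edgeFinset.card ≤ T.edgeFinset.card :=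
      Finset.card_le_card (SimpleGraph.edgeFinset_mono hGT)
    omega

theorem peel_step_aux {V : Type*} [Fintype V] [DecidableEq V]
    (F : SimpleGraph V) [DecidableRel F.Adj] (hF : F.IsAcyclic) (S : Finset V) :
    3 * (S.filter fun v => 3 ≤ (S.filter fun u => F.Adj v u).card).card ≤ 2 * S.card := by
  classical
  have h := sum_deg_le_aux (F.comap (Function.Embedding.subtype (· ∈ S))) (hF.of_comap _)
  have hd : ∀ v : {x // x ∈ S}, (F.comap (Function.Embedding.subtype (· ∈ S))).degree v
      = (S.filter fun u => F.Adj v u).card := by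
    intro v
    rw [← SimpleGraph.card_neighborFinset_eq_degree,
      ← Finset.card_map (Function.Embedding.subtype (· ∈ S))]
    congr 1
    ext u
    simp only [Finset.mem_map, SimpleGraph.mem_neighborFinset, Finset.mem_filter,
      SimpleGraph.comap_adj]
    constructor
    · rintro ⟨a, ha, rfl⟩
      exact ⟨a.2, ha⟩
    · rintro ⟨h1, h2⟩
      exact ⟨⟨u, h1⟩, h2, rfl⟩
  simp only [hd, Fintype.card_coe] at h
  rw [Finset.sum_coe_sort S (fun v => (S.filter fun u => F.Adj v u).card)] at h
  refine le_trans ?_ h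
  rw [mul_comm, ← smul_eq_mul]
  refine le_trans (Finset.card_nsmul_le_sum _ (fun v => (S.filter fun u => F.Adj v u).card) 3 ?_)
    (Finset.sum_le_sum_of_subset (Finset.filter_subset _ _))
  intro v hv
  exact (Finset.mem_filter.1 hv).2

/-- For a forest `F` on `n` vertices, iteratively peeling off
the vertices of (induced) degree at most `2` leaves at most `(2/3)^k · n`
vertices after `k` iterations. -/
theorem peeling_geometric_decay {V : Type*} [Fintype V] [DecidableEq V]
    (F : SimpleGraph V) [DecidableRel F.Adj] (hF : F.IsAcyclic)
    (S : ℕ → Finset V)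
    (hS0 : S 0 = Finset.univ)
    (hSsucc : ∀ k, S (k + 1) =
      (S k).filter fun v => 3 ≤ ((S k).filter fun u => F.Adj v u).card) :
    ∀ k : ℕ, ((S k).card : ℚ) ≤ (2 / 3) ^ k * Fintype.card V := by
  intro k
  induction k with
  | zero => simp [hS0]
  | succ k ih =>
    have h := peel_step_aux F hF (S k)
    rw [← hSsucc k] at h
    have h' : (3 : ℚ) * (S (k + 1)).card ≤ 2 * (S k).card := by exact_mod_cast h
    rw [pow_succ]
    linarith
end

section
/- Let G be a finite connected simple graph and let T1 and T2 be spanning trees of G. Then there exists a function f assigning to each edge of the symmetric difference E(T1) Δ E(T2) one of its two endpoints, such that every vertex v is assigned at most 2 edges of E(T1) \ E(T2) and at most 2 edges of E(T2) \ E(T1). Consequently, if every vertex v deletes from T1 its assigned edges of E(T1) \ E(T2) and adds its assigned edges of E(T2) \ E(T1), then every edge of E(T1) \ E(T2) is deleted by exactly one vertex, every edge of E(T2) \ E(T1) is added by exactly one vertex, and the resulting graph is T2. -/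
theorem aux_parent_unique {V : Type*} {T : SimpleGraph V} (hT : T.IsTree) (r : V) {v a b : V}
    (ha : T.Adj a v) (hb : T.Adj b v) (hda : T.dist r a < T.dist r v)
    (hdb : T.dist r b < T.dist r v) : a = b := by
  classical
  obtain ⟨p, hp, -⟩ := (hT.connected r v).exists_path_of_dist
  have key : ∀ c, T.Adj c v → T.dist r c < T.dist r v → c = p.penultimate := by
    intro c hc hd
    obtain ⟨q, hq, hq'⟩ := (hT.connected r c).exists_path_of_dist
    have hv : v ∉ q.support := by
      intro hv
      have h1 := SimpleGraph.dist_le (q.takeUntil v hv)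
      have h2 := q.length_takeUntil_le_length hv
      omega
    have h3 : q.concat hc = p :=
      (hT.existsUnique_path r v).unique (hq.concat hv hc) hp
    rw [← h3]; simp
  rw [key a ha hda, key b hb hdb]

theorem aux_orient {V : Type*} {T : SimpleGraph V} (hT : T.IsTree) :
    ∃ f : Sym2 V → V, (∀ e ∈ T.edgeSet, f e ∈ e) ∧
      ∀ e ∈ T.edgeSet, ∀ e' ∈ T.edgeSet, f e = f e' → e = e' := by
  classical
  have := hT.connected.nonempty
  let r : V := Classical.arbitrary V
  have h : ∀ e : Sym2 V, ∃ v : V, e ∈ T.edgeSet →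
      ∃ a, e = s(a, v) ∧ T.Adj a v ∧ T.dist r a < T.dist r v := by
    intro e
    induction e using Sym2.ind with
    | _ x y =>
      by_cases hxy : T.Adj x y
      · rcases hT.dist_eq_dist_add_one_of_adj r hxy with h | h
        · exact ⟨x, fun _ => ⟨y, Sym2.eq_swap, hxy.symm, by omega⟩⟩
        · exact ⟨y, fun _ => ⟨x, rfl, hxy, by omega⟩⟩
      · exact ⟨x, fun h => absurd h hxy⟩
  choose f hf using h
  refine ⟨f, fun e he => ?_, fun e he e' he' hee => ?_⟩
  · obtain ⟨a, h, -⟩ := hf e he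
    have : f e ∈ s(a, f e) := by simp
    rwa [← h] at this
  · obtain ⟨a, h1, h2, h3⟩ := hf e he
    obtain ⟨b, h4, h5, h6⟩ := hf e' he'
    rw [← hee] at h4 h5 h6
    rw [h1, h4, aux_parent_unique hT r h2 h5 h3 h6]


/-- For two spanning trees `T1`, `T2` of a finite connected
graph `G`, each edge of the symmetric difference `E(T1) Δ E(T2)` can be
assigned to one of its endpoints so that every vertex gets at most `2` edges
of `E(T1) \ E(T2)` and at most `2` edges of `E(T2) \ E(T1)`.  Consequently,
deleting from `T1` all edges of `E(T1) \ E(T2)` (each deleted by its unique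
assigned vertex) and adding all edges of `E(T2) \ E(T1)` (each added by its
unique assigned vertex) yields exactly the edge set of `T2`. -/
theorem spanning_tree_reconfig_two_simultaneous {V : Type*} [Fintype V]
    (G T1 T2 : SimpleGraph V)
    (hG : G.Connected)
    (hT1 : T1 ≤ G) (hT1tree : T1.IsTree)
    (hT2 : T2 ≤ G) (hT2tree : T2.IsTree) :
    (∃ f : Sym2 V → V,
      (∀ e ∈ (T1.edgeSet \ T2.edgeSet) ∪ (T2.edgeSet \ T1.edgeSet), f e ∈ e) ∧
      (∀ v : V, {e | e ∈ T1.edgeSet \ T2.edgeSet ∧ f e = v}.ncard ≤ 2) ∧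
      (∀ v : V, {e | e ∈ T2.edgeSet \ T1.edgeSet ∧ f e = v}.ncard ≤ 2)) ∧
    (T1.edgeSet \ (T1.edgeSet \ T2.edgeSet)) ∪ (T2.edgeSet \ T1.edgeSet)
      = T2.edgeSet := by
  classical
  refine ⟨?_, by ext e; simp only [Set.mem_union, Set.mem_sdiff]; tauto⟩
  obtain ⟨f1, h1, i1⟩ := aux_orient hT1tree
  obtain ⟨f2, h2, i2⟩ := aux_orient hT2tree
  refine ⟨fun e => if e ∈ T1.edgeSet then f1 e else f2 e, ?_, fun v => ?_, fun v => ?_⟩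
  · rintro e (⟨he, -⟩ | ⟨he, he'⟩)
    · simp only [if_pos he]; exact h1 e he
    · simp only [if_neg he']; exact h2 e he
  · refine le_trans ((Set.ncard_le_one_iff (Set.toFinite _)).2 ?_) one_le_two
    rintro a b ⟨⟨ha, -⟩, ha2⟩ ⟨⟨hb, -⟩, hb2⟩
    simp only [if_pos ha] at ha2
    simp only [if_pos hb] at hb2
    exact i1 a ha b hb (ha2.trans hb2.symm)
  · refine le_trans ((Set.ncard_le_one_iff (Set.toFinite _)).2 ?_) one_le_two
    rintro a b ⟨⟨ha, ha'⟩, ha2⟩ ⟨⟨hb, hb'⟩, hb2⟩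
    simp only [if_neg ha'] at ha2
    simp only [if_neg hb'] at hb2
    exact i2 a ha b hb (ha2.trans hb2.symm)
end

section
/- Let G be a finite connected simple graph and let T1 and T2 be spanning trees of G. Then there exists a function f assigning to each edge of the symmetric difference E(T1) Δ E(T2) one of its two endpoints, such that every vertex v is assigned at most 1 edge of E(T1) \ E(T2) and at most 1 edge of E(T2) \ E(T1). -/
theorem tree_parent_unique_aux {V : Type*} (T : SimpleGraph V) (hT : T.IsTree) (r v w w' : V)
    (h : T.Adj v w) (h' : T.Adj v w') (hd : T.dist r v = T.dist r w + 1)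
    (hd' : T.dist r v = T.dist r w' + 1) : w = w' := by
  obtain ⟨q, hq⟩ := (hT.connected r w).exists_walk_length_eq_dist
  obtain ⟨q', hq'⟩ := (hT.connected r w').exists_walk_length_eq_dist
  have hp : (q.concat h.symm).IsPath :=
    SimpleGraph.Walk.isPath_of_length_eq_dist _ (by simp [hq, hd])
  have hp' : (q'.concat h'.symm).IsPath :=
    SimpleGraph.Walk.isPath_of_length_eq_dist _ (by simp [hq', hd'])
  have := congrArg (fun p => p.penultimate) ((hT.existsUnique_path r v).unique hp hp')
  simpa using this

theorem tree_orient_aux {V : Type*} (T : SimpleGraph V) (hT : T.IsTree) :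
    ∃ f : Sym2 V → V, (∀ e ∈ T.edgeSet, f e ∈ e) ∧ Set.InjOn f T.edgeSet := by
  classical
  obtain ⟨r⟩ := hT.connected.nonempty
  have key : ∀ e : Sym2 V, ∃ v, e ∈ T.edgeSet →
      ∃ w, e = s(v, w) ∧ T.Adj v w ∧ T.dist r v = T.dist r w + 1 := by
    intro e
    by_cases he : e ∈ T.edgeSet
    · induction e using Sym2.ind with
      | _ x y =>
        have hxy : T.Adj x y := he
        rcases hT.dist_eq_dist_add_one_of_adj r hxy with h | h
        · exact ⟨x, fun _ => ⟨y, rfl, hxy, h⟩⟩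
        · exact ⟨y, fun _ => ⟨x, Sym2.eq_swap, hxy.symm, h⟩⟩
    · exact ⟨r, fun h => absurd h he⟩
  choose f hf using key
  refine ⟨f, fun e he => ?_, fun e he e' he' hee => ?_⟩
  · obtain ⟨w, hw, -, -⟩ := hf e he
    have : f e ∈ s(f e, w) := Sym2.mem_mk_left _ _
    rwa [← hw] at this
  · obtain ⟨w, hw, ha, hd⟩ := hf e he
    obtain ⟨w', hw', ha', hd'⟩ := hf e' he'
    rw [← hee] at hw' ha' hd'
    rw [hw, hw', tree_parent_unique_aux T hT r _ w w' ha ha' hd hd']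

/-- For two spanning trees `T1`, `T2` of a finite connected
graph `G`, each edge of the symmetric difference `E(T1) Δ E(T2)` can be
assigned to one of its endpoints so that every vertex gets at most `1` edge
of `E(T1) \ E(T2)` and at most `1` edge of `E(T2) \ E(T1)`. -/
theorem spanning_tree_reconfig_one_simultaneous {V : Type*} [Fintype V]
    (G T1 T2 : SimpleGraph V)
    (hG : G.Connected)
    (hT1 : T1 ≤ G) (hT1tree : T1.IsTree)
    (hT2 : T2 ≤ G) (hT2tree : T2.IsTree) :
    ∃ f : Sym2 V → V,
      (∀ e ∈ (T1.edgeSet \ T2.edgeSet) ∪ (T2.edgeSet \ T1.edgeSet), f e ∈ e) ∧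
      (∀ v : V, {e | e ∈ T1.edgeSet \ T2.edgeSet ∧ f e = v}.ncard ≤ 1) ∧
      (∀ v : V, {e | e ∈ T2.edgeSet \ T1.edgeSet ∧ f e = v}.ncard ≤ 1) := by
  classical
  obtain ⟨f1, hm1, hi1⟩ := tree_orient_aux T1 hT1tree
  obtain ⟨f2, hm2, hi2⟩ := tree_orient_aux T2 hT2tree
  refine ⟨fun e => if e ∈ T1.edgeSet then f1 e else f2 e, ?_, fun v => ?_, fun v => ?_⟩
  · rintro e (⟨h1, h2⟩ | ⟨h2, h1⟩)
    · simpa only [if_pos h1] using hm1 e h1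
    · simpa only [if_neg h1] using hm2 e h2
  · rw [Set.ncard_le_one (Set.toFinite _)]
    rintro a ⟨⟨ha, -⟩, hav⟩ b ⟨⟨hb, -⟩, hbv⟩
    simp only [if_pos ha] at hav
    simp only [if_pos hb] at hbv
    exact hi1 ha hb (hav.trans hbv.symm)
  · rw [Set.ncard_le_one (Set.toFinite _)]
    rintro a ⟨⟨ha, ha'⟩, hav⟩ b ⟨⟨hb, hb'⟩, hbv⟩
    simp only [if_neg ha'] at hav
    simp only [if_neg hb'] at hbv
    exact hi2 ha hb (hav.trans hbv.symm)
end

section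
/- Let T be a tree on a finite vertex set V with |V| = n ≥ 1, and let f be an injective function from the edge set of T to V such that f(e) is an endpoint of e for every edge e. Then there is exactly one vertex r ∈ V that is not in the image of f, and for every edge e = {u, v} of T with f(e) = u, the distance in T from u to r equals the distance in T from v to r plus 1. In other words, f assigns to each edge its endpoint farther from r, so f is precisely the parent-pointer assignment of the rooting of T at r. -/
/-- If `T` is a tree on `n ≥ 1` vertices and `f` is an
injective choice of an endpoint for each edge of `T`, then exactly one vertex
`r` is missed by `f`, and every edge `e = {u, v}` with `f e = u` points away
from `r` (i.e. `dist(u, r) = dist(v, r) + 1`): `f` is the parent-pointer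
assignment of the rooting of `T` at `r`. -/
theorem tree_injective_orientation_is_rooting {V : Type*} [Fintype V]
    (T : SimpleGraph V) (hT : T.IsTree) (hn : 1 ≤ Fintype.card V)
    (f : T.edgeSet → V) (hinj : Function.Injective f)
    (hend : ∀ e : T.edgeSet, f e ∈ (e : Sym2 V)) :
    ∃ r : V, (∀ x : V, x ∉ Set.range f ↔ x = r) ∧
      ∀ (u v : V) (h : T.Adj u v),
        f ⟨s(u, v), T.mem_edgeSet.mpr h⟩ = u →
          T.dist u r = T.dist v r + 1 := by
  have hcard : ((Set.range f)ᶜ).ncard = 1 := by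
    have h1 := (SimpleGraph.isTree_iff_connected_and_card.mp hT).2
    have h2 := Set.ncard_add_ncard_compl (Set.range f)
    have h3 : (Set.range f).ncard = Nat.card T.edgeSet := by
      rw [← Nat.card_coe_set_eq]
      exact Nat.card_range_of_injective hinj
    omega
  obtain ⟨r, hr⟩ := Set.ncard_eq_one.mp hcard
  have hr' : ∀ x : V, x ∉ Set.range f ↔ x = r := by
    intro x
    have : x ∈ (Set.range f)ᶜ ↔ x ∈ ({r} : Set V) := by rw [hr]
    simpa only [Set.mem_compl_iff, Set.mem_singleton_iff] using this
  refine ⟨r, hr', ?_⟩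
  have hdich : ∀ {a b : V}, T.Adj a b →
      T.dist a r = T.dist b r + 1 ∨ T.dist b r = T.dist a r + 1 := by
    intro a b hab
    have := hT.dist_eq_dist_add_one_of_adj r hab
    rw [T.dist_comm (u := a), T.dist_comm (u := b)]
    omega
  have key : ∀ (d : ℕ) (u v : V) (h : T.Adj u v), T.dist v r = d → T.dist u r = d + 1 →
      f ⟨s(u, v), T.mem_edgeSet.mpr h⟩ = u := by
    intro d
    induction d using Nat.strong_induction_on with
    | _ d ih =>
      intro u v h hv hu
      have hm := hend ⟨s(u, v), T.mem_edgeSet.mpr h⟩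
      rcases Sym2.mem_iff.mp hm with h1 | h1
      · exact h1
      exfalso
      have hvr : v ≠ r := fun hc => (hr' v).mpr hc ⟨_, h1⟩
      obtain ⟨p, hp⟩ := hT.connected.exists_walk_length_eq_dist v r
      cases p with
      | nil => exact hvr rfl
      | @cons _ w _ hvw q =>
        have hq := SimpleGraph.dist_le q
        rw [SimpleGraph.Walk.length_cons] at hp
        have h2 := ih (T.dist w r) (by omega) v w hvw rfl
          (by have := hdich hvw; omega)
        have h3 := congrArg Subtype.val (hinj (h1.trans h2.symm))
        have h4 : u = w := by
          have h5 : s(v, u) = s(v, w) := by rw [Sym2.eq_swap]; exact h3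
          exact Sym2.congr_right.mp h5
        subst h4
        omega
  intro u v h hf
  rcases hdich h with h1 | h1
  · exact h1
  · exfalso
    have h2 := key _ v u h.symm rfl h1
    have h3 : (⟨s(v, u), T.mem_edgeSet.mpr h.symm⟩ : T.edgeSet) =
        ⟨s(u, v), T.mem_edgeSet.mpr h⟩ := Subtype.ext Sym2.eq_swap
    rw [h3, hf] at h2
    exact h.ne h2
end
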